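/- arXiv:2605.31334 — 2 statements merged into one kernel-verified Lean document; each statement's English description precedes it below -/
import Mathlib

section
/- There exists an alternating 4-form Ψ on ℝ⁸ such that for every pair of linearly independent vectors v, w ∈ ℝ⁸ the 8-form (v⌟w⌟Ψ)∧(v⌟w⌟Ψ)∧Ψ is a strictly positive multiple of vol₀, and yet Ψ is not admissible, i.e. Ψ ≠ g*Φ₀ for every g ∈ GL(8,ℝ). -/
open scoped TensorProduct
open Matrix

noncomputable section

/-- `ℝ⁸` with its standard basis. -/
abbrev V : Type := Fin 8 → ℝ

/-- Alternating `k`-forms on `ℝ⁸`. -/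
abbrev Form (k : ℕ) : Type := V [⋀^Fin k]→ₗ[ℝ] ℝ

/-- Standard basis vector `eᵢ` of `ℝ⁸`. -/
def e (i : Fin 8) : V := Pi.single i 1

/-- The elementary 4-form `eⁱ∧eʲ∧eᵏ∧eˡ` (determinant convention). -/
def E4 (i j k l : Fin 8) : Form 4 :=
  (Matrix.detRowAlternating : (Fin 4 → ℝ) [⋀^Fin 4]→ₗ[ℝ] ℝ).compLinearMap
    (LinearMap.funLeft ℝ ℝ ![i, j, k, l])

/-- The Cayley 4-form `Φ₀` on `ℝ⁸` (indices shifted from `1,…,8` to `0,…,7`):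
`Φ₀ = e^{1234}+e^{1256}+e^{1278}+e^{1357}−e^{1368}−e^{1458}−e^{1467}
      +e^{5678}+e^{3478}+e^{3456}+e^{2468}−e^{2457}−e^{2367}−e^{2358}`. -/
def Φ₀ : Form 4 :=
  E4 0 1 2 3 + E4 0 1 4 5 + E4 0 1 6 7 + E4 0 2 4 6 - E4 0 2 5 7 - E4 0 3 4 7 - E4 0 3 5 6
    + E4 4 5 6 7 + E4 2 3 6 7 + E4 2 3 4 5 + E4 1 3 5 7 - E4 1 3 4 6 - E4 1 2 5 6 - E4 1 2 4 7

/-- The standard volume form `e¹∧e²∧⋯∧e⁸` of `ℝ⁸`. -/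
def vol₀ : Form 8 := Matrix.detRowAlternating

/-- The wedge product of alternating forms (shuffle convention, so that
`(e¹∧e²)(e₁,e₂) = 1`). -/
def wedge {k l : ℕ} (α : Form k) (β : Form l) : Form (k + l) :=
  AlternatingMap.domDomCongr finSumFinEquiv
    ((LinearMap.mul' ℝ ℝ).compAlternatingMap (AlternatingMap.domCoprod α β))

/-- The double contraction `v ⌟ w ⌟ Φ`, i.e. the alternating 2-form
`(x, y) ↦ Φ (w, v, x, y)`. -/
def contr (v w : V) (Φ : Form 4) : Form 2 :=
  AlternatingMap.curryLeft (AlternatingMap.curryLeft Φ w) v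

/-- The inner product on alternating `k`-forms on `ℝ⁸` making the forms
`e^{i₁}∧⋯∧e^{i_k}` with `i₁<⋯<i_k` an orthonormal basis. -/
def formInner {k : ℕ} (α β : Form k) : ℝ :=
  ∑ s : Finset (Fin 8),
    if h : s.card = k then
      α (fun a => e ((s.orderIsoOfFin h a : Fin 8))) *
        β (fun a => e ((s.orderIsoOfFin h a : Fin 8)))
    else 0

/-- A 4-form `Ψ` on `ℝ⁸` is admissible (a `Spin(7)`-form) if `Ψ = g*Φ₀` for some
`g ∈ GL(8,ℝ)`, where `(g*Φ₀)(x,y,z,w) = Φ₀(gx,gy,gz,gw)`. -/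
def Admissible (Ψ : Form 4) : Prop :=
  ∃ g : V →ₗ[ℝ] V, Function.Bijective g ∧ Ψ = Φ₀.compLinearMap g

section Wedge

variable {k l : ℕ}

theorem wedge_add_right (α : Form k) (β γ : Form l) :
    wedge α (β + γ) = wedge α β + wedge α γ := by
  ext x
  simp [wedge, ← AlternatingMap.domCoprod'_apply, TensorProduct.tmul_add]

theorem wedge_smul_right (α : Form k) (c : ℝ) (β : Form l) :
    wedge α (c • β) = c • wedge α β := by
  ext x
  simp [wedge, ← AlternatingMap.domCoprod'_apply]

theorem wedge_sub_right (α : Form k) (β γ : Form l) :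
    wedge α (β - γ) = wedge α β - wedge α γ := by
  ext x
  simp [wedge, ← AlternatingMap.domCoprod'_apply, TensorProduct.tmul_sub]

theorem wedge_apply (α : Form k) (β : Form l) (x : Fin (k + l) → V) :
    wedge α β x = ∑ σ, LinearMap.mul' ℝ ℝ
      (AlternatingMap.domCoprod.summand α β σ (x ∘ finSumFinEquiv)) := by
  simp only [wedge, AlternatingMap.domDomCongr_apply, LinearMap.compAlternatingMap_apply,
    AlternatingMap.domCoprod_apply, _root_.sum_apply, map_sum]

theorem wedge_compLinearMap (α : Form k) (β : Form l) (g : V →ₗ[ℝ] V) :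
    wedge (α.compLinearMap g) (β.compLinearMap g) = (wedge α β).compLinearMap g := by
  ext x
  simp only [wedge_apply, AlternatingMap.compLinearMap_apply]
  refine Finset.sum_congr rfl fun σ _ => ?_
  induction σ using Quotient.inductionOn'
  rfl

/-- If `β` only sees the last `l` of the vectors `x`, then a single shuffle contributes to
`(α ∧ β) x`. -/
theorem wedge_apply_of_shuffle (α : Form k) (β : Form l) (x : Fin (k + l) → V)
    (h : ∀ σ : Equiv.Perm (Fin k ⊕ Fin l), (β fun i => x (finSumFinEquiv (σ (Sum.inr i)))) ≠ 0 →
      σ ∈ (Equiv.Perm.sumCongrHom (Fin k) (Fin l)).range) :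
    wedge α β x = (α fun i => x (Fin.castAdd l i)) * β fun i => x (Fin.natAdd k i) := by
  rw [wedge_apply]
  refine (Finset.sum_eq_single (Quotient.mk'' 1) ?_ ?_).trans ?_
  · intro σ _ hσ
    induction σ using Quotient.inductionOn' with | _ σ
    have hβ : (β fun i => x (finSumFinEquiv (σ (Sum.inr i)))) = 0 := by
      by_contra hne
      refine hσ (Quotient.sound' ?_)
      rw [QuotientGroup.leftRel_apply]
      simpa using h σ hne
    simp [AlternatingMap.domCoprod.summand_mk'', hβ]
  · simp
  · simp [AlternatingMap.domCoprod.summand_mk'']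

theorem wedge_self_apply (ω : Form 2) (x : Fin 4 → V) :
    wedge ω ω x = 2 * (ω ![x 0, x 1] * ω ![x 2, x 3] - ω ![x 0, x 2] * ω ![x 1, x 3]
      + ω ![x 0, x 3] * ω ![x 1, x 2]) := by
  obtain ⟨b, hb⟩ : ∃ b : V → V → ℝ, ∀ y, ω y = b (y 0) (y 1) :=
    ⟨fun y z => ω ![y, z], fun y => congrArg ω <| by ext i : 1; fin_cases i <;> rfl⟩
  have hswap (y z : V) : b y z = -b z y := by
    simpa [hb] using ω.map_swap ![z, y] (show (0 : Fin 2) ≠ 1 by decide)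
  have f0 : finSumFinEquiv (Sum.inl 0 : Fin 2 ⊕ Fin 2) = 0 := rfl
  have f1 : finSumFinEquiv (Sum.inl 1 : Fin 2 ⊕ Fin 2) = 1 := rfl
  have f2 : finSumFinEquiv (Sum.inr 0 : Fin 2 ⊕ Fin 2) = 2 := rfl
  have f3 : finSumFinEquiv (Sum.inr 1 : Fin 2 ⊕ Fin 2) = 3 := rfl
  have d1 {n : ℕ} (p : Fin (n + 2)) (σ) : Equiv.Perm.decomposeFin.symm (p, σ) 1 =
      Equiv.swap 0 p (σ 0).succ := Equiv.Perm.decomposeFin_symm_apply_succ σ p 0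
  have d2 (p : Fin 4) (σ) : Equiv.Perm.decomposeFin.symm (p, σ) 2 =
      Equiv.swap 0 p (σ 1).succ := Equiv.Perm.decomposeFin_symm_apply_succ σ p 1
  have d3 (p : Fin 4) (σ) : Equiv.Perm.decomposeFin.symm (p, σ) 3 =
      Equiv.swap 0 p (σ 2).succ := Equiv.Perm.decomposeFin_symm_apply_succ σ p 2
  have d2' (p : Fin 3) (σ) : Equiv.Perm.decomposeFin.symm (p, σ) 2 =
      Equiv.swap 0 p (σ 1).succ := Equiv.Perm.decomposeFin_symm_apply_succ σ p 1
  have h := congrArg (fun f => LinearMap.mul' ℝ ℝ (f (x ∘ finSumFinEquiv)))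
    (MultilinearMap.domCoprod_alternization_eq ω ω)
  have hw : LinearMap.mul' ℝ ℝ (ω.domCoprod ω (x ∘ finSumFinEquiv)) = wedge ω ω x := rfl
  simp only [MultilinearMap.alternatization_apply, map_sum, AlternatingMap.smul_apply, map_nsmul,
    hw] at h
  rw [← Equiv.sum_comp (finSumFinEquiv (m := 2) (n := 2)).symm.permCongr] at h
  simp only [Equiv.Perm.sign_permCongr] at h
  simp only [← Equiv.sum_comp Equiv.Perm.decomposeFin.symm, Fintype.sum_prod_type] at h
  simp [Fin.sum_univ_succ, Equiv.Perm.decomposeFin.symm_sign, hb, f0, f1, f2, f3,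
    d1, d2, d3, d2', Equiv.swap_apply_def] at h
  rw [hswap (x 1) (x 0), hswap (x 2) (x 0), hswap (x 3) (x 0), hswap (x 2) (x 1),
    hswap (x 3) (x 1), hswap (x 3) (x 2)] at h
  simp only [hb, cons_val_zero, cons_val_one]
  linear_combination -h / 4

end Wedge

theorem E4_apply (i j k l : Fin 8) (x : Fin 4 → V) :
    E4 i j k l x = det (of fun a b => x a (![i, j, k, l] b)) := rfl

theorem wedge_E4_perm_apply (γ : Form 4) (π : Equiv.Perm (Fin 8)) (hπ : Equiv.Perm.sign π = 1) :
    wedge γ (E4 (π 4) (π 5) (π 6) (π 7)) e = γ ![e (π 0), e (π 1), e (π 2), e (π 3)] := by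
  have hperm : wedge γ (E4 (π 4) (π 5) (π 6) (π 7)) (e ∘ π) =
      wedge γ (E4 (π 4) (π 5) (π 6) (π 7)) e := by
    rw [AlternatingMap.map_perm, hπ, one_smul]
  have hQ : ![π 4, π 5, π 6, π 7] = fun i : Fin 4 => π (Fin.natAdd 4 i) := by
    ext i; fin_cases i <;> rfl
  rw [← hperm, wedge_apply_of_shuffle]
  · have hE : (E4 (π 4) (π 5) (π 6) (π 7) fun i => (e ∘ π) (Fin.natAdd 4 i)) = 1 := by
      have h1 : (of fun a b => (e ∘ π) (Fin.natAdd 4 a) (π (Fin.natAdd 4 b))) =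
          (1 : Matrix (Fin 4) (Fin 4) ℝ) := by
        ext a b
        simp only [of_apply, Function.comp_apply, e, Pi.single_apply, one_apply,
          π.injective.eq_iff, (Fin.natAdd_injective 4 4).eq_iff, eq_comm]
      rw [← det_one (n := Fin 4), ← h1, E4_apply, hQ]
    rw [hE, mul_one]
    refine congrArg γ (funext fun i => ?_)
    fin_cases i <;> rfl
  · intro σ hσ
    refine Equiv.Perm.mem_sumCongrHom_range_of_perm_mapsTo_inl
      ((Equiv.Perm.perm_mapsTo_inl_iff_mapsTo_inr σ).2 ?_)
    rintro _ ⟨i, rfl⟩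
    rcases hi : σ (Sum.inr i) with c | c
    · refine absurd (det_eq_zero_of_row_eq_zero i fun b => ?_) hσ
      have hne : Fin.natAdd 4 b ≠ Fin.castAdd 4 c := by
        simp only [ne_eq, Fin.ext_iff, Fin.val_natAdd, Fin.val_castAdd]
        omega
      simp only [hQ, hi, LinearMap.funLeft_apply, Function.comp_apply, e,
        finSumFinEquiv_apply_left]
      exact Pi.single_eq_of_ne (π.injective.ne hne) _
    · exact ⟨c, rfl⟩

theorem wedge_E4_apply (γ : Form 4) {a b c d i j k l : Fin 8}
    (hbij : Function.Bijective ![a, b, c, d, i, j, k, l])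
    (hsign : Equiv.Perm.sign (Equiv.ofBijective _ hbij) = 1) :
    wedge γ (E4 i j k l) e = γ ![e a, e b, e c, e d] := by
  simpa only [Equiv.ofBijective_apply, cons_val] using
    wedge_E4_perm_apply γ (.ofBijective _ hbij) hsign

/-- Laplace expansion along the first two arguments. -/
theorem E4_apply_vec (i j k l : Fin 8) (w v x y : V) :
    E4 i j k l ![w, v, x, y] =
      (w i * v j - w j * v i) * (x k * y l - x l * y k)
      - (w i * v k - w k * v i) * (x j * y l - x l * y j)
      + (w i * v l - w l * v i) * (x j * y k - x k * y j)
      + (w j * v k - w k * v j) * (x i * y l - x l * y i)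
      - (w j * v l - w l * v j) * (x i * y k - x k * y i)
      + (w k * v l - w l * v k) * (x i * y j - x j * y i) := by
  rw [E4_apply]
  simp [det_succ_row_zero, Fin.sum_univ_succ, Fin.succAbove]
  ring

theorem eq_smul_vol₀ (f : Form 8) : f = f e • vol₀ := by
  have h := f.eq_smul_basis_det (Pi.basisFun ℝ (Fin 8))
  rw [Pi.basisFun_det] at h
  convert h using 3
  ext i
  · simp [e]
  · rfl

theorem apply_eq_mul_vol₀ (f : Form 8) (x : Fin 8 → V) : f x = f e * vol₀ x :=
  DFunLike.congr_fun (eq_smul_vol₀ f) x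

theorem wedge_Φ₀_apply (γ : Form 4) :
    wedge γ Φ₀ e =
      γ ![e 4, e 5, e 6, e 7] + γ ![e 2, e 3, e 6, e 7] + γ ![e 2, e 3, e 4, e 5]
        + γ ![e 1, e 3, e 5, e 7] - γ ![e 1, e 3, e 4, e 6] - γ ![e 1, e 2, e 5, e 6]
        - γ ![e 1, e 2, e 4, e 7] + γ ![e 0, e 1, e 2, e 3] + γ ![e 0, e 1, e 4, e 5]
        + γ ![e 0, e 1, e 6, e 7] + γ ![e 0, e 2, e 4, e 6] - γ ![e 0, e 2, e 5, e 7]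
        - γ ![e 0, e 3, e 4, e 7] - γ ![e 0, e 3, e 5, e 6] := by
  simp only [Φ₀, wedge_add_right, wedge_sub_right, AlternatingMap.add_apply,
    AlternatingMap.sub_apply,
    wedge_E4_apply γ (a := 4) (b := 5) (c := 6) (d := 7) (i := 0) (j := 1) (k := 2) (l := 3)
      (by decide) (by decide),
    wedge_E4_apply γ (a := 2) (b := 3) (c := 6) (d := 7) (i := 0) (j := 1) (k := 4) (l := 5)
      (by decide) (by decide),
    wedge_E4_apply γ (a := 2) (b := 3) (c := 4) (d := 5) (i := 0) (j := 1) (k := 6) (l := 7)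
      (by decide) (by decide),
    wedge_E4_apply γ (a := 1) (b := 3) (c := 5) (d := 7) (i := 0) (j := 2) (k := 4) (l := 6)
      (by decide) (by decide),
    wedge_E4_apply γ (a := 1) (b := 3) (c := 4) (d := 6) (i := 0) (j := 2) (k := 5) (l := 7)
      (by decide) (by decide),
    wedge_E4_apply γ (a := 1) (b := 2) (c := 5) (d := 6) (i := 0) (j := 3) (k := 4) (l := 7)
      (by decide) (by decide),
    wedge_E4_apply γ (a := 1) (b := 2) (c := 4) (d := 7) (i := 0) (j := 3) (k := 5) (l := 6)
      (by decide) (by decide),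
    wedge_E4_apply γ (a := 0) (b := 1) (c := 2) (d := 3) (i := 4) (j := 5) (k := 6) (l := 7)
      (by decide) (by decide),
    wedge_E4_apply γ (a := 0) (b := 1) (c := 4) (d := 5) (i := 2) (j := 3) (k := 6) (l := 7)
      (by decide) (by decide),
    wedge_E4_apply γ (a := 0) (b := 1) (c := 6) (d := 7) (i := 2) (j := 3) (k := 4) (l := 5)
      (by decide) (by decide),
    wedge_E4_apply γ (a := 0) (b := 2) (c := 4) (d := 6) (i := 1) (j := 3) (k := 5) (l := 7)
      (by decide) (by decide),
    wedge_E4_apply γ (a := 0) (b := 2) (c := 5) (d := 7) (i := 1) (j := 3) (k := 4) (l := 6)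
      (by decide) (by decide),
    wedge_E4_apply γ (a := 0) (b := 3) (c := 4) (d := 7) (i := 1) (j := 2) (k := 5) (l := 6)
      (by decide) (by decide),
    wedge_E4_apply γ (a := 0) (b := 3) (c := 5) (d := 6) (i := 1) (j := 2) (k := 4) (l := 7)
      (by decide) (by decide)]

/-- The Cayley form with the coefficient of `e^{1234}` changed to `1 + t`. -/
def deformedCayley (t : ℝ) : Form 4 := Φ₀ + t • E4 0 1 2 3

theorem wedge_contr_deformedCayley_apply (t : ℝ) (v w : V) :
    wedge (wedge (contr v w (deformedCayley t)) (contr v w (deformedCayley t)))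
      (deformedCayley t) e =
    6 * ((v ⬝ᵥ v) * (w ⬝ᵥ w) - (v ⬝ᵥ w) ^ 2) +
      6 * t * (
        ((v 0 * w 1 - v 1 * w 0) + (v 2 * w 3 - v 3 * w 2)) *
          ((v 0 * w 1 - v 1 * w 0) + (v 2 * w 3 - v 3 * w 2)
            + (v 4 * w 5 - v 5 * w 4) + (v 6 * w 7 - v 7 * w 6)) +
        ((v 0 * w 2 - v 2 * w 0) - (v 1 * w 3 - v 3 * w 1)) *
          ((v 0 * w 2 - v 2 * w 0) - (v 1 * w 3 - v 3 * w 1)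
            + (v 4 * w 6 - v 6 * w 4) - (v 5 * w 7 - v 7 * w 5)) +
        ((v 0 * w 3 - v 3 * w 0) + (v 1 * w 2 - v 2 * w 1)) *
          ((v 0 * w 3 - v 3 * w 0) + (v 1 * w 2 - v 2 * w 1)
            - (v 4 * w 7 - v 7 * w 4) - (v 5 * w 6 - v 6 * w 5))) := by
  set ω := contr v w (deformedCayley t)
  have hΨ : wedge (wedge ω ω) (deformedCayley t) e =
      wedge (wedge ω ω) Φ₀ e + t * wedge ω ω ![e 4, e 5, e 6, e 7] := by
    rw [deformedCayley, wedge_add_right, wedge_smul_right, AlternatingMap.add_apply,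
      AlternatingMap.smul_apply, smul_eq_mul, wedge_E4_apply (wedge ω ω) (a := 4) (b := 5) (c := 6)
      (d := 7) (i := 0) (j := 1) (k := 2) (l := 3) (by decide) (by decide)]
  rw [hΨ, wedge_Φ₀_apply]
  simp only [wedge_self_apply, cons_val]
  have hval (a b : Fin 8) : ω ![e a, e b] = deformedCayley t ![w, v, e a, e b] := rfl
  clear_value ω
  simp only [hval]
  simp only [deformedCayley, Φ₀, AlternatingMap.add_apply, AlternatingMap.sub_apply,
    AlternatingMap.smul_apply, smul_eq_mul, E4_apply_vec, e, Pi.single_apply]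
  simp
  simp only [dotProduct, Fin.sum_univ_eight]
  ring

theorem gram_pos {v w : V} (h : LinearIndependent ℝ ![v, w]) :
    0 < (v ⬝ᵥ v) * (w ⬝ᵥ w) - (v ⬝ᵥ w) ^ 2 := by
  have pos (x : V) (hx : x ≠ 0) : 0 < x ⬝ᵥ x :=
    (Finset.sum_nonneg fun i _ => mul_self_nonneg (x i)).lt_of_ne'
      (dotProduct_self_eq_zero.not.2 hx)
  have hv : 0 < v ⬝ᵥ v := pos v (h.ne_zero 0)
  refine pos_of_mul_pos_right ?_ hv.le
  have hu := pos ((-(v ⬝ᵥ w)) • v + (v ⬝ᵥ v) • w) fun h0 =>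
    hv.ne' (LinearIndependent.pair_iff.1 h _ _ h0).2
  simp only [dotProduct_add, add_dotProduct, dotProduct_smul, smul_dotProduct, smul_eq_mul,
    dotProduct_comm w v] at hu
  linarith

theorem wedge_contr_deformedCayley_pos {v w : V} (h : LinearIndependent ℝ ![v, w]) :
    0 < wedge (wedge (contr v w (deformedCayley 1)) (contr v w (deformedCayley 1)))
      (deformedCayley 1) e := by
  have hpos := gram_pos h
  obtain ⟨q, hq⟩ : ∃ q : Fin 8 → Fin 8 → ℝ, ∀ i j, q i j = v i * w j - v j * w i :=
    ⟨_, fun _ _ => rfl⟩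
  have lagrange : (v ⬝ᵥ v) * (w ⬝ᵥ w) - (v ⬝ᵥ w) ^ 2 =
      (∑ i : Fin 4, ∑ j : Fin 4, q (i.castAdd 4) (j.natAdd 4) ^ 2) +
        (q 0 1 ^ 2 + q 0 2 ^ 2 + q 0 3 ^ 2 + q 1 2 ^ 2 + q 1 3 ^ 2 + q 2 3 ^ 2) +
        (q 4 5 ^ 2 + q 4 6 ^ 2 + q 4 7 ^ 2 + q 5 6 ^ 2 + q 5 7 ^ 2 + q 6 7 ^ 2) := by
    simp only [hq, dotProduct, Fin.sum_univ_eight, Fin.sum_univ_four, Fin.reduceCastAdd,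
      Fin.reduceNatAdd]
    ring
  have hcross : 0 ≤ ∑ i : Fin 4, ∑ j : Fin 4, q (i.castAdd 4) (j.natAdd 4) ^ 2 := by positivity
  rw [wedge_contr_deformedCayley_apply]
  simp only [← hq]
  nlinarith [sq_nonneg (q 0 1), sq_nonneg (q 0 2), sq_nonneg (q 0 3), sq_nonneg (q 1 2),
    sq_nonneg (q 1 3), sq_nonneg (q 2 3),
    sq_nonneg (2 * (q 0 1 + q 2 3) + (q 4 5 + q 6 7)), sq_nonneg (q 4 5 - q 6 7),
    sq_nonneg (2 * (q 0 2 - q 1 3) + (q 4 6 - q 5 7)), sq_nonneg (q 4 6 + q 5 7),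
    sq_nonneg (2 * (q 0 3 + q 1 2) - (q 4 7 + q 5 6)), sq_nonneg (q 4 7 - q 5 6)]

theorem Admissible.exists_gram {Ψ : Form 4} (h : Admissible Ψ) :
    ∃ (g : V →ₗ[ℝ] V) (r : ℝ), ∀ v w, wedge (wedge (contr v w Ψ) (contr v w Ψ)) Ψ e =
      r * ((g v ⬝ᵥ g v) * (g w ⬝ᵥ g w) - (g v ⬝ᵥ g w) ^ 2) := by
  obtain ⟨g, -, rfl⟩ := h
  refine ⟨g, 6 * vol₀ fun i => g (e i), fun v w => ?_⟩
  have hcontr : contr v w (Φ₀.compLinearMap g) = (contr (g v) (g w) Φ₀).compLinearMap g := by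
    ext x
    refine congrArg Φ₀ (funext fun i => ?_)
    fin_cases i <;> rfl
  have hΦ₀ : Φ₀ = deformedCayley 0 := by simp [deformedCayley]
  rw [hcontr, wedge_compLinearMap, wedge_compLinearMap, AlternatingMap.compLinearMap_apply,
    apply_eq_mul_vol₀ (wedge _ Φ₀), hΦ₀, wedge_contr_deformedCayley_apply]
  ring

/-- If the area form `r * (|v|²|w|² - ⟨v, w⟩²)` is additive along `(x, y + z)` and `(z, x + y)`,
then `y` and `z` are orthogonal. -/
theorem dotProduct_eq_zero_of_gram_add {r : ℝ} {f : V → V → ℝ} {g : V →ₗ[ℝ] V}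
    (hf : ∀ v w, f v w = r * ((g v ⬝ᵥ g v) * (g w ⬝ᵥ g w) - (g v ⬝ᵥ g w) ^ 2)) {x y z : V}
    (hx : f x (y + z) = f x y + f x z) (hz : f z (x + y) = f z x + f z y) (h0 : f x z ≠ 0) :
    g y ⬝ᵥ g z = 0 := by
  simp only [hf, map_add, dotProduct_add, add_dotProduct] at hx hz h0
  rw [dotProduct_comm (g z) (g x), dotProduct_comm (g z) (g y), dotProduct_comm (g y) (g x)] at *
  refine (mul_eq_zero.1 ?_).resolve_right h0
  linear_combination (g z ⬝ᵥ g z) / 2 * hx + (g x ⬝ᵥ g z) / 2 * hz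

theorem not_admissible_deformedCayley : ¬ Admissible (deformedCayley 1) := by
  intro h
  obtain ⟨g, r, hg⟩ := h.exists_gram
  set f : V → V → ℝ := fun v w => wedge (wedge (contr v w (deformedCayley 1))
    (contr v w (deformedCayley 1))) (deformedCayley 1) e
  have hf := wedge_contr_deformedCayley_apply 1
  change ∀ v w, f v w = _ at hg hf
  clear_value f
  have h01 : f (e 0) (e 1) = 12 := by simp [hf, e]; norm_num
  have h45 : f (e 4) (e 5) = 6 := by simp [hf, e]
  have h04 : f (e 0) (e 4) = 6 := by simp [hf, e]
  have h15 : f (e 1) (e 5) = 6 := by simp [hf, e]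
  have g01 : g (e 0) ⬝ᵥ g (e 1) = 0 := by
    apply dotProduct_eq_zero_of_gram_add hg (x := e 4) <;> simp [hf, e] <;> norm_num
  have g04 : g (e 0) ⬝ᵥ g (e 4) = 0 := by
    apply dotProduct_eq_zero_of_gram_add hg (x := e 1) <;> simp [hf, e] <;> norm_num
  have g45 : g (e 4) ⬝ᵥ g (e 5) = 0 := by
    apply dotProduct_eq_zero_of_gram_add hg (x := e 1) <;> simp [hf, e] <;> norm_num
  have g15 : g (e 1) ⬝ᵥ g (e 5) = 0 := by
    apply dotProduct_eq_zero_of_gram_add hg (x := e 4) <;> simp [hf, e] <;> norm_num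
  have key : f (e 0) (e 1) * f (e 4) (e 5) = f (e 0) (e 4) * f (e 1) (e 5) := by
    simp only [hg, g01, g04, g45, g15]
    ring
  norm_num [h01, h45, h04, h15] at key

/-- **The positivity identity does not characterise `Spin(7)`-forms:** there exists an
alternating 4-form `Ψ` on `ℝ⁸` such that for every pair of linearly independent vectors
`v, w` the 8-form `(v⌟w⌟Ψ)∧(v⌟w⌟Ψ)∧Ψ` is a strictly positive multiple of `vol₀`, and yet
`Ψ` is not admissible. -/
theorem positive_not_admissible :
    ∃ Ψ : Form 4,
      (∀ v w : V, LinearIndependent ℝ ![v, w] →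
        ∃ c : ℝ, 0 < c ∧ wedge (wedge (contr v w Ψ) (contr v w Ψ)) Ψ = c • vol₀) ∧
      ¬ Admissible Ψ := by
  exact ⟨deformedCayley 1,
    fun _ _ h => ⟨_, wedge_contr_deformedCayley_pos h, eq_smul_vol₀ _⟩,
    not_admissible_deformedCayley⟩

end
end

section
/- Let Λ²₇ = ker(M − 3·id), a 7-dimensional subspace of the alternating 2-forms on ℝ⁸. The linear map tr from the 56-dimensional space of maps γ : {1,…,8} → Λ²₇ to ℝ⁸, defined by tr(γ)_j = Σ_{i=1}^{8} γ(i)(e_j, e_i), is surjective; consequently its kernel {γ : tr(γ) = 0} is a 48-dimensional subspace. -/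
open scoped TensorProduct
open Matrix

noncomputable section

/-- The decomposable form `e^{u 0} ∧ ⋯ ∧ e^{u (k-1)}`. -/
def elemForm {k : ℕ} (u : Fin k → Fin 8) : Form k :=
  (Matrix.detRowAlternating : (Fin k → ℝ) [⋀^Fin k]→ₗ[ℝ] ℝ).compLinearMap
    (LinearMap.funLeft ℝ ℝ u)

theorem elemForm_apply {k : ℕ} (u : Fin k → Fin 8) (v : Fin k → V) :
    elemForm u v = Matrix.det (Matrix.of fun a b => v a (u b)) := rfl

theorem elemForm_eq_alternatization {k : ℕ} (u : Fin k → Fin 8) :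
    elemForm u = MultilinearMap.alternatization
      ((MultilinearMap.mkPiAlgebra ℝ (Fin k) ℝ).compLinearMap fun a => LinearMap.proj (u a)) := by
  ext v
  simp [elemForm, Matrix.detRowAlternating, MultilinearMap.alternatization_apply,
    LinearMap.funLeft]

theorem wedge_elemForm {k l : ℕ} (u : Fin k → Fin 8) (v : Fin l → Fin 8) :
    wedge (elemForm u) (elemForm v) = elemForm (Fin.append u v) := by
  ext x
  simp only [wedge, elemForm_eq_alternatization, ← MultilinearMap.domCoprod_alternization,
    ← LinearMap.compMultilinearMap_alternatization, AlternatingMap.domDomCongr_apply,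
    MultilinearMap.alternatization_apply]
  rw [← Equiv.sum_comp (finSumFinEquiv.permCongr)]
  refine Finset.sum_congr rfl fun σ _ => ?_
  rw [Equiv.Perm.sign_permCongr]
  simp [Fin.prod_univ_add]

theorem form_sum_apply {k : ℕ} {ι : Type*} (s : Finset ι) (f : ι → Form k) (v : Fin k → V) :
    (∑ t ∈ s, f t) v = ∑ t ∈ s, f t v :=
  map_sum (⟨⟨fun α => α v, rfl⟩, fun _ _ => rfl⟩ : Form k →+ ℝ) f s

theorem wedge_sum_smul {k l : ℕ} {ι : Type*} [Fintype ι] (α : Form k) (c : ι → ℝ)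
    (β : ι → Form l) : wedge α (∑ t, c t • β t) = ∑ t, c t • wedge α (β t) := by
  let L : Form l →ₗ[ℝ] Form (k + l) :=
    { toFun := wedge α
      map_add' := fun β γ => by
        ext v
        simp [wedge, ← AlternatingMap.domCoprod'_apply, TensorProduct.tmul_add]
      map_smul' := fun c β => by
        ext v
        simp [wedge, ← AlternatingMap.domCoprod'_apply] }
  have hL (γ : Form l) : wedge α γ = L γ := rfl
  simp only [hL, map_sum, map_smul]

/-- The sign of a self-map of `Fin n`, which is zero unless the map is a permutation. -/
def mapSign {n : ℕ} (w : Fin n → Fin n) : ℤ :=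
  ∏ i, ∏ j ∈ Finset.Ioi i, Int.sign ((w j : ℕ) - (w i : ℕ) : ℤ)

theorem det_submatrix_one {n : ℕ} (w : Fin n → Fin n) :
    ((1 : Matrix (Fin n) (Fin n) ℝ).submatrix id w).det = mapSign w := by
  by_cases hw : Function.Injective w
  · obtain ⟨σ, rfl⟩ : ∃ σ : Equiv.Perm (Fin n), σ = w :=
      ⟨Equiv.ofBijective w (Finite.injective_iff_bijective.mp hw), rfl⟩
    have h := σ.prod_Ioi_comp_eq_sign_mul_prod
      (f := fun i j => Int.sign ((j : ℕ) - (i : ℕ) : ℤ))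
      (fun i j => by rw [← Int.sign_neg, neg_sub])
    have h1 : ∏ i : Fin n, ∏ j ∈ Finset.Ioi i, Int.sign ((j : ℕ) - (i : ℕ) : ℤ) = 1 :=
      Finset.prod_eq_one fun i _ => Finset.prod_eq_one fun j hj =>
        Int.sign_eq_one_of_pos (by have := Finset.mem_Ioi.mp hj; omega)
    rw [Matrix.det_permute', Matrix.det_one, mapSign, h, h1]
    simp
  · obtain ⟨i, j, hij, hlt⟩ : ∃ i j, w i = w j ∧ i < j := by
      simp only [Function.Injective, not_forall] at hw
      obtain ⟨i, j, hij, hne⟩ := hw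
      rcases lt_or_gt_of_ne hne with h | h
      exacts [⟨i, j, hij, h⟩, ⟨j, i, hij.symm, h⟩]
    have hcol (a : Fin n) : (1 : Matrix (Fin n) (Fin n) ℝ).submatrix id w a i =
        (1 : Matrix (Fin n) (Fin n) ℝ).submatrix id w a j := by
      rw [Matrix.submatrix_apply, Matrix.submatrix_apply, hij]
    have hsign : mapSign w = 0 :=
      Finset.prod_eq_zero (Finset.mem_univ i)
        (Finset.prod_eq_zero (Finset.mem_Ioi.mpr hlt) (by simp [hij]))
    rw [Matrix.det_zero_of_column_eq hlt.ne hcol, hsign, Int.cast_zero]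

theorem elemForm_apply_e (w : Fin 8 → Fin 8) : elemForm w e = mapSign w := by
  rw [elemForm_apply, ← det_submatrix_one]
  congr 1
  ext a b
  simp [e, Matrix.one_apply, Pi.single_apply, eq_comm]

theorem detRowAlternating_single (n : ℕ) :
    (Matrix.detRowAlternating : (Fin n → ℝ) [⋀^Fin n]→ₗ[ℝ] ℝ) (fun i => Pi.single i 1) = 1 := by
  have h : (Matrix.of fun i : Fin n => (Pi.single i 1 : Fin n → ℝ)) = 1 := by
    ext a b
    simp [Matrix.one_apply, Pi.single_apply, eq_comm]
  exact (congrArg Matrix.det h).trans Matrix.det_one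

theorem vol₀_apply_e : vol₀ e = 1 := by
  have he : e = fun i => Pi.single i 1 := rfl
  rw [vol₀, he, detRowAlternating_single 8]

/-- The index quadruples of the terms of the Cayley form. -/
def cayleyIndex : Fin 14 → Fin 4 → Fin 8 :=
  ![![0, 1, 2, 3], ![0, 1, 4, 5], ![0, 1, 6, 7], ![0, 2, 4, 6], ![0, 2, 5, 7], ![0, 3, 4, 7],
    ![0, 3, 5, 6], ![4, 5, 6, 7], ![2, 3, 6, 7], ![2, 3, 4, 5], ![1, 3, 5, 7], ![1, 3, 4, 6],
    ![1, 2, 5, 6], ![1, 2, 4, 7]]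

/-- The signs of the terms of the Cayley form. -/
def cayleySign : Fin 14 → ℤ := ![1, 1, 1, 1, -1, -1, -1, 1, 1, 1, 1, -1, -1, -1]

theorem Φ₀_eq_sum : Φ₀ = ∑ t, (cayleySign t : ℝ) • elemForm (cayleyIndex t) := by
  have hE (i j k l : Fin 8) : E4 i j k l = elemForm ![i, j, k, l] := rfl
  ext v
  simp [Fin.sum_univ_succ, cayleySign, cayleyIndex, Φ₀, hE]
  ring

/-- The signs relating the components of a form in `Λ²₇` to its components along `e₀`. -/
def pairSign : Fin 8 → Fin 8 → ℤ :=
  ![![0, 1, 1, 1, 1, 1, 1, 1],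
    ![-1, 0, 1, -1, 1, -1, 1, -1],
    ![-1, -1, 0, 1, 1, -1, -1, 1],
    ![-1, 1, -1, 0, -1, -1, 1, 1],
    ![-1, -1, -1, 1, 0, 1, 1, -1],
    ![-1, 1, 1, 1, -1, 0, -1, -1],
    ![-1, -1, 1, -1, -1, 1, 0, 1],
    ![-1, 1, -1, -1, 1, 1, -1, 0]]

/-- The component matrices of the basis of `Λ²₇` dual to the components along `e₀`. -/
def coeff (m : Fin 7) (i j : Fin 8) : ℤ :=
  if (i : ℕ) ^^^ (j : ℕ) = m + 1 then pairSign i j else 0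

theorem coeff_swap : ∀ m i j, coeff m j i = -coeff m i j := by decide +kernel

theorem coeff_zero_succ : ∀ m n : Fin 7, coeff m 0 n.succ = if m = n then 1 else 0 := by
  decide +kernel

theorem sum_coeff_mul_coeff :
    ∀ m n, ∑ i, ∑ j, coeff m i j * coeff n i j = if m = n then 8 else 0 := by
  decide +kernel

/-- The sign of a list of distinct numbers as an arrangement, or zero if there is a repetition. -/
def listSign : List ℕ → ℤ
  | [] => 1
  | a :: l => if a ∈ l then 0 else (l.map fun b : ℕ => Int.sign ((b : ℤ) - a)).prod * listSign l

theorem listSign_ofFn {n : ℕ} (w : Fin n → ℕ) :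
    listSign (List.ofFn w) = ∏ i, ∏ j ∈ Finset.Ioi i, Int.sign ((w j : ℤ) - w i) := by
  induction n with
  | zero => simp [listSign]
  | succ n ih =>
    rw [List.ofFn_succ, listSign, ih, Fin.prod_univ_succ, Fin.prod_Ioi_zero]
    simp only [Fin.prod_Ioi_succ, List.map_ofFn, List.prod_ofFn, Function.comp_apply]
    split_ifs with h
    · obtain ⟨j, hj⟩ := (List.mem_ofFn' _ _).mp h
      rw [Finset.prod_eq_zero (Finset.mem_univ j) (by simp [hj]), zero_mul]
    · rfl

theorem cayley_component_list : ∀ i j k l : Fin 8,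
    ∑ t, cayleySign t * listSign (i :: j :: k :: l :: List.ofFn fun a => (cayleyIndex t a : ℕ)) =
      ∑ m, coeff m i j * coeff m k l -
        ((if i = k ∧ j = l then 1 else 0) - if i = l ∧ j = k then 1 else 0) := by
  decide +kernel

theorem cayley_component (i j k l : Fin 8) :
    ∑ t, cayleySign t * mapSign (Fin.append (Fin.append ![i, j] ![k, l]) (cayleyIndex t)) =
      ∑ m, coeff m i j * coeff m k l -
        ((if i = k ∧ j = l then 1 else 0) - if i = l ∧ j = k then 1 else 0) := by
  rw [← cayley_component_list]
  refine Finset.sum_congr rfl fun t _ => congrArg _ ?_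
  refine (listSign_ofFn _).symm.trans (congrArg listSign ?_)
  rfl

theorem elemForm_pair_apply (i j k l : Fin 8) :
    elemForm ![i, j] ![e k, e l] =
      (((if i = k ∧ j = l then 1 else 0) - if i = l ∧ j = k then 1 else 0 : ℤ) : ℝ) := by
  rw [elemForm_apply, Matrix.det_fin_two]
  simp only [e, Matrix.of_apply, Matrix.cons_val_zero, Matrix.cons_val_one, Pi.single_apply]
  split_ifs <;> simp_all

theorem form_two_swap (α : Form 2) (x y : V) : α ![y, x] = -α ![x, y] := by
  rw [← α.map_swap ![x, y] (i := 0) (j := 1) (by decide)]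
  congr 1
  ext a : 1
  fin_cases a <;> rfl

theorem form_two_ext {α β : Form 2}
    (h : ∀ k l : Fin 8, k < l → α ![e k, e l] = β ![e k, e l]) : α = β := by
  refine (Pi.basisFun ℝ (Fin 8)).ext_alternating fun v hv => ?_
  have hv' : (fun a => Pi.basisFun ℝ (Fin 8) (v a)) = ![e (v 0), e (v 1)] := by
    ext a : 1
    fin_cases a <;> simp [e]
  rw [hv']
  rcases lt_or_gt_of_ne (hv.ne (show (0 : Fin 2) ≠ 1 by decide)) with hlt | hlt
  · exact h _ _ hlt
  · rw [form_two_swap, h _ _ hlt, ← form_two_swap]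

theorem form_two_eq_sum (α : Form 2) :
    α = ∑ i, ∑ j, (α ![e i, e j] / 2) • elemForm ![i, j] := by
  refine form_two_ext fun k l _ => ?_
  simp [form_sum_apply, elemForm_pair_apply, mul_sub, Finset.sum_sub_distrib, ite_and,
    form_two_swap α (e k) (e l)]
  ring

theorem formInner_elemForm (α : Form 2) {k l : Fin 8} (h : k < l) :
    formInner α (elemForm ![k, l]) = α ![e k, e l] := by
  have hc : ({k, l} : Finset (Fin 8)).card = 2 := Finset.card_pair h.ne
  have hord (s : Finset (Fin 8)) (hs : s.card = 2) :
      (fun a => e (s.orderIsoOfFin hs a : Fin 8)) =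
        ![e (s.orderEmbOfFin hs 0), e (s.orderEmbOfFin hs 1)] := by
    ext a : 1
    fin_cases a <;> rfl
  have hpair : ![k, l] = ({k, l} : Finset (Fin 8)).orderEmbOfFin hc := by
    refine Finset.orderEmbOfFin_unique hc (fun a => by fin_cases a <;> simp) ?_
    intro a b hab
    fin_cases a <;> fin_cases b <;> simp_all
  rw [formInner, Finset.sum_eq_single ({k, l} : Finset (Fin 8))]
  · rw [dif_pos hc, hord, ← hpair, elemForm_pair_apply]
    simp [h.ne]
  · intro s _ hne
    split_ifs with hs
    · have hlt : s.orderEmbOfFin hs 0 < s.orderEmbOfFin hs 1 :=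
        (s.orderEmbOfFin hs).strictMono (by decide)
      have h0 := s.orderEmbOfFin_mem hs 0
      have h1 := s.orderEmbOfFin_mem hs 1
      rw [hord, elemForm_pair_apply, if_neg, if_neg]
      · simp
      · rintro ⟨hk, hl⟩
        rw [← hk, ← hl] at hlt
        exact hlt.asymm h
      · rintro ⟨hk, hl⟩
        refine hne (Finset.eq_of_subset_of_card_le ?_ (by rw [hc, hs])).symm
        rw [Finset.insert_subset_iff, Finset.singleton_subset_iff, hk, hl]
        exact ⟨h0, h1⟩
    · rfl
  · simp

/-- The basis of `Λ²₇` dual to the components along `e₀`. -/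
def basisForm (m : Fin 7) : Form 2 :=
  ∑ i, ∑ j, ((coeff m i j : ℝ) / 2) • elemForm ![i, j]

theorem basisForm_apply (m : Fin 7) (k l : Fin 8) :
    basisForm m ![e k, e l] = coeff m k l := by
  simp [basisForm, form_sum_apply, elemForm_pair_apply, mul_sub, Finset.sum_sub_distrib,
    ite_and, coeff_swap m k l]
  ring

theorem finrank_ker_add_of_surjective {W : Type*} [AddCommMonoid W] [Module ℝ W]
    [Module.Finite ℝ W] {T : W →ₗ[ℝ] V} (hT : Function.Surjective T) :
    Module.finrank ℝ (LinearMap.ker T) + 8 = Module.finrank ℝ W := by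
  let _ : AddCommGroup W := Module.addCommMonoidToAddCommGroup ℝ
  have h := LinearMap.finrank_range_add_finrank_ker T
  rw [LinearMap.range_eq_top.mpr hT, finrank_top, Module.finrank_fin_fun] at h
  omega

theorem linearIndependent_basisForm : LinearIndependent ℝ basisForm := by
  refine Fintype.linearIndependent_iff.mpr fun g hg n => ?_
  have h := congrArg (fun α : Form 2 => α ![e 0, e n.succ]) hg
  simpa [form_sum_apply, basisForm_apply, coeff_zero_succ] using h

theorem map_elemForm_add_self {M : Form 2 →ₗ[ℝ] Form 2}
    (hM : ∀ α β : Form 2, wedge (wedge α β) Φ₀ = formInner (M α) β • vol₀)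
    (i j : Fin 8) :
    M (elemForm ![i, j]) + elemForm ![i, j] = ∑ m, (coeff m i j : ℝ) • basisForm m := by
  refine form_two_ext fun k l hkl => ?_
  have h := congrArg (fun ω : Form 8 => ω e) (hM (elemForm ![i, j]) (elemForm ![k, l]))
  simp only [formInner_elemForm _ hkl, Φ₀_eq_sum, wedge_sum_smul, wedge_elemForm] at h
  have h' : ∑ t, (cayleySign t : ℝ) *
      mapSign (Fin.append (Fin.append ![i, j] ![k, l]) (cayleyIndex t)) =
      M (elemForm ![i, j]) ![e k, e l] := by
    simpa [form_sum_apply, elemForm_apply_e, vol₀_apply_e] using h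
  have hc := congrArg (Int.cast : ℤ → ℝ) (cayley_component i j k l)
  rw [Int.cast_sub, Int.cast_sum] at hc
  simp only [Int.cast_mul] at hc
  rw [AlternatingMap.add_apply, ← h', hc, elemForm_pair_apply]
  simp [form_sum_apply, basisForm_apply]

theorem map_basisForm {M : Form 2 →ₗ[ℝ] Form 2}
    (hM : ∀ α β : Form 2, wedge (wedge α β) Φ₀ = formInner (M α) β • vol₀)
    (n : Fin 7) : M (basisForm n) = (3 : ℝ) • basisForm n := by
  have h : M (basisForm n) + basisForm n =
      ∑ i, ∑ j, ((coeff n i j : ℝ) / 2) • ∑ m, (coeff m i j : ℝ) • basisForm m := by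
    simp only [← map_elemForm_add_self hM, smul_add, Finset.sum_add_distrib]
    conv_lhs => rw [basisForm]
    simp only [map_sum, map_smul]
  have horth (m : Fin 7) : ∑ i, ∑ j, (coeff n i j : ℝ) * coeff m i j = if n = m then 8 else 0 := by
    exact_mod_cast sum_coeff_mul_coeff n m
  refine form_two_ext fun k l _ => ?_
  have h' := congrArg (fun α : Form 2 => α ![e k, e l]) h
  simp only [AlternatingMap.add_apply, form_sum_apply, AlternatingMap.smul_apply, smul_eq_mul,
    basisForm_apply, Finset.mul_sum] at h' ⊢
  have hcomm : ∑ i, ∑ j, ∑ m, (coeff n i j : ℝ) / 2 * (coeff m i j * coeff m k l) =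
      ∑ m, (∑ i, ∑ j, (coeff n i j : ℝ) * coeff m i j) * (coeff m k l / 2) := by
    simp only [Finset.sum_mul]
    rw [Finset.sum_comm (s := (Finset.univ : Finset (Fin 7)))]
    refine Finset.sum_congr rfl fun i _ => ?_
    rw [Finset.sum_comm (s := (Finset.univ : Finset (Fin 7)))]
    exact Finset.sum_congr rfl fun j _ => Finset.sum_congr rfl fun m _ => by ring
  rw [hcomm] at h'
  simp [horth] at h'
  linarith

theorem map_add_self_mem_span {M : Form 2 →ₗ[ℝ] Form 2}
    (hM : ∀ α β : Form 2, wedge (wedge α β) Φ₀ = formInner (M α) β • vol₀)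
    (α : Form 2) :
    M α + α ∈ Submodule.span ℝ (Set.range basisForm) := by
  rw [form_two_eq_sum α]
  simp only [map_sum, map_smul, ← Finset.sum_add_distrib, ← smul_add, map_elemForm_add_self hM]
  exact Submodule.sum_mem _ fun i _ => Submodule.sum_mem _ fun j _ => Submodule.smul_mem _ _ <|
    Submodule.sum_mem _ fun m _ => Submodule.smul_mem _ _ <|
      Submodule.subset_span (Set.mem_range_self m)

theorem ker_eq_span {M : Form 2 →ₗ[ℝ] Form 2}
    (hM : ∀ α β : Form 2, wedge (wedge α β) Φ₀ = formInner (M α) β • vol₀) :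
    LinearMap.ker (M - (3 : ℝ) • LinearMap.id) = Submodule.span ℝ (Set.range basisForm) := by
  refine le_antisymm (fun α hα => ?_) (Submodule.span_le.mpr ?_)
  · have h3 : M α = (3 : ℝ) • α := by simpa [sub_eq_zero] using hα
    have h4 := Submodule.smul_mem _ (1 / 4 : ℝ) (map_add_self_mem_span hM α)
    rw [h3] at h4
    convert h4 using 1
    module
  · rintro _ ⟨m, rfl⟩
    simp [map_basisForm hM m]

/-- **The splitting `Ω¹₈ ⊗ Ω²₇ ≅ Ω¹₈ ⊕ Ω³₄₈` (Proposition 2.14, pointwise):** with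
`Λ²₇ := ker(M − 3·id)` (a 7-dimensional subspace of 2-forms), the linear map `tr` from
the 56-dimensional space of maps `γ : {1,…,8} → Λ²₇` to `ℝ⁸` defined by
`tr(γ)_j = Σᵢ γ(i)(e_j, e_i)` is surjective; consequently its kernel is a
48-dimensional subspace. -/
theorem torsion_trace_surjective (M : Form 2 →ₗ[ℝ] Form 2)
    (hM : ∀ α β : Form 2, wedge (wedge α β) Φ₀ = formInner (M α) β • vol₀)
    (T : (Fin 8 → ↥(LinearMap.ker (M - (3 : ℝ) • LinearMap.id))) →ₗ[ℝ] V)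
    (hT : ∀ γ, ∀ j : Fin 8, T γ j = ∑ i : Fin 8, (γ i : Form 2) ![e j, e i]) :
    Module.finrank ℝ (Fin 8 → ↥(LinearMap.ker (M - (3 : ℝ) • LinearMap.id))) = 56 ∧
    Function.Surjective T ∧
    Module.finrank ℝ (LinearMap.ker T) = 48 := by
  have hker := ker_eq_span hM
  have hmem (m : Fin 7) : basisForm m ∈ LinearMap.ker (M - (3 : ℝ) • LinearMap.id) :=
    hker ▸ Submodule.subset_span (Set.mem_range_self m)
  have hfin : Module.finrank ℝ (LinearMap.ker (M - (3 : ℝ) • LinearMap.id)) = 7 := by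
    rw [hker, finrank_span_eq_card linearIndependent_basisForm, Fintype.card_fin]
  have : Module.Free ℝ (LinearMap.ker (M - (3 : ℝ) • LinearMap.id)) :=
    Module.Free.of_basis ((Module.Basis.span linearIndependent_basisForm).map
      (LinearEquiv.ofEq _ _ hker.symm))
  have : Module.Finite ℝ (LinearMap.ker (M - (3 : ℝ) • LinearMap.id)) :=
    Module.finite_of_finrank_pos (by omega)
  have hdim : Module.finrank ℝ (Fin 8 → LinearMap.ker (M - (3 : ℝ) • LinearMap.id)) = 56 := by
    rw [Module.finrank_pi_fintype]
    simp [hfin]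
  have hsurj : Function.Surjective T := by
    have hsingle (i : Fin 8) (x : LinearMap.ker (M - (3 : ℝ) • LinearMap.id)) (j : Fin 8) :
        T (Pi.single i x) j = (x : Form 2) ![e j, e i] := by
      rw [hT, Finset.sum_eq_single i (fun b _ hb => by simp [hb]) (by simp), Pi.single_eq_same]
    have hzero : ∀ j : Fin 7, coeff 0 j.succ 1 = 0 ∧ coeff j 0 0 = 0 := by decide
    have hone : coeff 0 0 1 = 1 := by decide
    intro v
    refine ⟨Pi.single 0 (∑ n : Fin 7, (-v n.succ) • ⟨basisForm n, hmem n⟩) +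
      Pi.single 1 (v 0 • ⟨basisForm 0, hmem 0⟩), funext fun j => ?_⟩
    rw [map_add, Pi.add_apply, hsingle, hsingle, AddSubmonoidClass.coe_finsetSum,
      form_sum_apply]
    simp only [Submodule.coe_smul, AlternatingMap.smul_apply, basisForm_apply, smul_eq_mul]
    cases j using Fin.cases with
    | zero => simp [hzero, hone]
    | succ p => simp [hzero, coeff_swap _ 0 p.succ, coeff_zero_succ]
  have hrank := finrank_ker_add_of_surjective hsurj
  exact ⟨hdim, hsurj, by omega⟩

end
end
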